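/- Fix 1 ≤ m ≤ l and r ≥ 0, and let λ, μ ∈ 𝒫^l_n with |λ_T(r,m)| = |μ_T(r,m)|. If t is a λ_B(r,m)-column-dominated standard μ_B(r,m)-tableau and s is a λ_T(r,m)-column-dominated standard μ_T(r,m)-tableau, then the glued tableau t #̄ s is a λ-column-dominated standard μ-tableau. -/

import Mathlib

namespace FS

open scoped Classical

/-- A node `(r, c, m)`: row `r`, column `c`, component `m` (all 1-based). -/
abbrev Node := ℕ × ℕ × ℕ

/-- Membership of a node in the Young diagram of the multipartition `p`,
where `p m r` is the `r`-th part of the `m`-th component. -/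
def InDiag (p : ℕ → ℕ → ℕ) (A : Node) : Prop :=
  1 ≤ A.2.1 ∧ A.2.1 ≤ p A.2.2 A.1

/-- `p` is an `l`-multipartition of `n` (components indexed `1,…,l`, rows indexed `1,…`). -/
def IsMP (l n : ℕ) (p : ℕ → ℕ → ℕ) : Prop :=
  (∀ m r, (m = 0 ∨ l < m ∨ r = 0 ∨ n < r) → p m r = 0) ∧
  (∀ m r, 1 ≤ r → p m (r + 1) ≤ p m r) ∧
  (∑ m ∈ Finset.Icc 1 l, ∑ r ∈ Finset.Icc 1 n, p m r) = n

/-- Total size of an `l`-multicomposition (rows bounded by `n`). -/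
def mpSize (l n : ℕ) (p : ℕ → ℕ → ℕ) : ℕ :=
  ∑ m ∈ Finset.Icc 1 l, ∑ r ∈ Finset.Icc 1 n, p m r

/-- Size of the `m`-th component. -/
def compSize (n : ℕ) (p : ℕ → ℕ → ℕ) (m : ℕ) : ℕ :=
  ∑ r ∈ Finset.Icc 1 n, p m r

/-- Length of column `c` of component `m`, i.e. `(p^(m))'_c`. -/
def colLen (n : ℕ) (p : ℕ → ℕ → ℕ) (m c : ℕ) : ℕ :=
  ((Finset.Icc 1 n).filter fun r => c ≤ p m r).card

/-- Dominance order on `l`-multicompositions: `Dom l N p q` means `p ⊵ q`. -/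
def Dom (l N : ℕ) (p q : ℕ → ℕ → ℕ) : Prop :=
  ∀ m r, 1 ≤ m → m ≤ l →
    (∑ m' ∈ Finset.Icc 1 (m - 1), compSize N q m') + ∑ r' ∈ Finset.Icc 1 r, q m r' ≤
      (∑ m' ∈ Finset.Icc 1 (m - 1), compSize N p m') + ∑ r' ∈ Finset.Icc 1 r, p m r'

/-- `t` is a `p`-tableau: a bijection from the diagram of `p` onto `{1,…,n}`. -/
def IsTab (n : ℕ) (p : ℕ → ℕ → ℕ) (t : Node → ℕ) : Prop :=
  (∀ A, InDiag p A → 1 ≤ t A ∧ t A ≤ n) ∧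
  (∀ A B, InDiag p A → InDiag p B → t A = t B → A = B) ∧
  (∀ i, 1 ≤ i → i ≤ n → ∃ A, InDiag p A ∧ t A = i)

/-- Entries increase from left to right along each row. -/
def RowStrict (p : ℕ → ℕ → ℕ) (t : Node → ℕ) : Prop :=
  ∀ r c m, InDiag p (r, c, m) → InDiag p (r, c + 1, m) → t (r, c, m) < t (r, c + 1, m)

/-- Entries increase down each column. -/
def ColStrict (p : ℕ → ℕ → ℕ) (t : Node → ℕ) : Prop :=
  ∀ r c m, InDiag p (r, c, m) → InDiag p (r + 1, c, m) → t (r, c, m) < t (r + 1, c, m)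

/-- A standard tableau is both row-strict and column-strict. -/
def IsStd (p : ℕ → ℕ → ℕ) (t : Node → ℕ) : Prop := RowStrict p t ∧ ColStrict p t

/-- The tableau `t_λ`, obtained by writing `1,…,n` in order down successive columns
from left to right (components from `l` down to `1`). -/
def colTab (l n : ℕ) (p : ℕ → ℕ → ℕ) : Node → ℕ := fun A =>
  (∑ m' ∈ Finset.Icc (A.2.2 + 1) l, compSize n p m') +
    (∑ c' ∈ Finset.Icc 1 (A.2.1 - 1), colLen n p A.2.2 c') + A.1

/-- The tableau `t^λ`, obtained by writing `1,…,n` in order along successive rows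
from top to bottom (components from `1` up to `l`). -/
def rowTab (n : ℕ) (p : ℕ → ℕ → ℕ) : Node → ℕ := fun A =>
  (∑ m' ∈ Finset.Icc 1 (A.2.2 - 1), compSize n p m') +
    (∑ r' ∈ Finset.Icc 1 (A.1 - 1), p A.2.2 r') + A.2.1

/-- The Coxeter generator `s_i = (i, i+1)` of the symmetric group. -/
def sw (i : ℕ) : Equiv.Perm ℕ := Equiv.swap i (i + 1)

/-- The product `s_{i_1} ⋯ s_{i_k}` corresponding to a word `L = [i_1,…,i_k]`. -/
def wordProd (L : List ℕ) : Equiv.Perm ℕ := (L.map sw).prod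

/-- `L` is an expression for `w` in the Coxeter generators `s_1,…,s_{n-1}` of `S_n`. -/
def IsWord (n : ℕ) (L : List ℕ) (w : Equiv.Perm ℕ) : Prop :=
  (∀ i ∈ L, 1 ≤ i ∧ i + 1 ≤ n) ∧ wordProd L = w

/-- The Coxeter length of `w ∈ S_n`. -/
noncomputable def len (n : ℕ) (w : Equiv.Perm ℕ) : ℕ :=
  sInf {k | ∃ L, IsWord n L w ∧ L.length = k}

/-- `L` is a reduced expression for `w ∈ S_n`. -/
def IsReduced (n : ℕ) (L : List ℕ) (w : Equiv.Perm ℕ) : Prop :=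
  IsWord n L w ∧ L.length = len n w

/-- The Bruhat order on `S_n`: `x ≤ w` iff some reduced expression for `w` has an
expression for `x` as a subsequence. -/
def BruhatLE (n : ℕ) (x w : Equiv.Perm ℕ) : Prop :=
  ∃ L, IsReduced n L w ∧ ∃ L', L'.Sublist L ∧ wordProd L' = x

/-- Strict Bruhat order. -/
def BruhatLT (n : ℕ) (x w : Equiv.Perm ℕ) : Prop := BruhatLE n x w ∧ x ≠ w

/-- The left (weak) order on `S_n`: `x ≤_L w` iff `ℓ(w) = ℓ(w x⁻¹) + ℓ(x)`. -/
def LeftLE (n : ℕ) (x w : Equiv.Perm ℕ) : Prop :=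
  len n w = len n (w * x⁻¹) + len n x

/-- `w` is a permutation of `{1,…,n}` (fixing everything else). -/
def PermOf (n : ℕ) (w : Equiv.Perm ℕ) : Prop := ∀ i, i = 0 ∨ n < i → w i = i

/-- `w` is the permutation sending the base tableau `base` to the tableau `t`
(e.g. `w = w_t` when `base = t_λ`). -/
def IsPermOfTab (n : ℕ) (p : ℕ → ℕ → ℕ) (base t : Node → ℕ) (w : Equiv.Perm ℕ) : Prop :=
  PermOf n w ∧ ∀ A, InDiag p A → w (base A) = t A

/-- `Shape(t↓j)`: the multicomposition whose `(m, r)` entry is the number of nodes in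
row `r` of component `m` whose entry under `t` is at most `j`. -/
def shape (n : ℕ) (p : ℕ → ℕ → ℕ) (t : Node → ℕ) (j : ℕ) : ℕ → ℕ → ℕ :=
  fun m r => ((Finset.Icc 1 n).filter fun c => c ≤ p m r ∧ t (r, c, m) ≤ j).card

/-- `Shape(t↓j)'`: the conjugate multicomposition, whose `(m, c)` entry is the number of
nodes in column `c` of component `l + 1 - m` whose entry under `t` is at most `j`. -/
def shapeConj (l n : ℕ) (p : ℕ → ℕ → ℕ) (t : Node → ℕ) (j : ℕ) : ℕ → ℕ → ℕ :=
  fun m c => ((Finset.Icc 1 n).filter fun r => c ≤ p (l + 1 - m) r ∧ t (r, c, l + 1 - m) ≤ j).card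

/-- `A` lies weakly to the left of `B`. -/
def WeaklyLeft (A B : Node) : Prop :=
  B.2.2 < A.2.2 ∨ (A.2.2 = B.2.2 ∧ A.2.1 ≤ B.2.1)

/-- `A` lies weakly above `B`. -/
def WeaklyAbove (A B : Node) : Prop :=
  A.2.2 < B.2.2 ∨ (A.2.2 = B.2.2 ∧ A.1 ≤ B.1)

/-- `A` lies weakly to the right of `B`. -/
def WeaklyRight (A B : Node) : Prop :=
  A.2.2 < B.2.2 ∨ (A.2.2 = B.2.2 ∧ B.2.1 ≤ A.2.1)

/-- `t` (a `mu`-tableau) is `lam`-column-dominated on `1,…,j`: each `i ≤ j` appears in `t`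
at least as far to the left as it does in `t_lam`. -/
def ColDomOn (l n : ℕ) (lam mu : ℕ → ℕ → ℕ) (t : Node → ℕ) (j : ℕ) : Prop :=
  ∀ i A B, 1 ≤ i → i ≤ j → InDiag mu A → t A = i → InDiag lam B →
    colTab l n lam B = i → WeaklyLeft A B

/-- `t` is weakly `lam`-column-dominated on `1,…,j`: each `i ≤ j` appears in `t` in a
component at least as far to the left as it does in `t_lam`. -/
def WColDomOn (l n : ℕ) (lam mu : ℕ → ℕ → ℕ) (t : Node → ℕ) (j : ℕ) : Prop :=
  ∀ i A B, 1 ≤ i → i ≤ j → InDiag mu A → t A = i → InDiag lam B →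
    colTab l n lam B = i → B.2.2 ≤ A.2.2

/-- `t` (a `mu`-tableau) is `lam`-row-dominated on `1,…,j`: each `i ≤ j` appears in `t`
at least as high as it does in `t^lam`. -/
def RowDomOn (n : ℕ) (lam mu : ℕ → ℕ → ℕ) (t : Node → ℕ) (j : ℕ) : Prop :=
  ∀ i A B, 1 ≤ i → i ≤ j → InDiag mu A → t A = i → InDiag lam B →
    rowTab n lam B = i → WeaklyAbove A B

/-- The multipartition `λ_L(c, m)`: the first `c` columns of component `m`, followed by
components `m+1,…,l`. -/
def leftPart (lam : ℕ → ℕ → ℕ) (c m : ℕ) : ℕ → ℕ → ℕ := fun k r =>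
  if k = 0 then 0 else if k = 1 then min (lam m r) c else lam (m + k - 1) r

/-- The multipartition `λ_R(c, m)`: components `1,…,m-1`, followed by the part of
component `m` after its first `c` columns. -/
def rightPart (lam : ℕ → ℕ → ℕ) (c m : ℕ) : ℕ → ℕ → ℕ := fun k r =>
  if k < m then lam k r else if k = m then lam m r - c else 0

/-- The multipartition `λ_T(r₀, m)`: components `1,…,m-1`, followed by the first `r₀`
rows of component `m`. -/
def topPart (lam : ℕ → ℕ → ℕ) (r₀ m : ℕ) : ℕ → ℕ → ℕ := fun k r =>
  if k < m then lam k r else if k = m then (if r ≤ r₀ then lam m r else 0) else 0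

/-- The multipartition `λ_B(r₀, m)`: the rows of component `m` after row `r₀`, followed
by components `m+1,…,l`. -/
def botPart (lam : ℕ → ℕ → ℕ) (r₀ m : ℕ) : ℕ → ℕ → ℕ := fun k r =>
  if k = 0 ∨ r = 0 then 0 else if k = 1 then lam m (r₀ + r) else lam (m + k - 1) r

/-- The glued tableau `t_L # t_R`: places `1,…,n_L` on the left part as in `t_L`, and
places `n_L + t_R(A)` at the node corresponding to each node `A` of the right part. -/
def glueLR (nL c m : ℕ) (tL tR : Node → ℕ) : Node → ℕ := fun A =>
  if A.2.2 < m then nL + tR A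
  else if A.2.2 = m then
    (if A.2.1 ≤ c then tL (A.1, A.2.1, 1) else nL + tR (A.1, A.2.1 - c, m))
  else tL (A.1, A.2.1, A.2.2 - m + 1)

/-- The tableau `t⁺` obtained from a tableau `t` of `μ_R(1,m)` by increasing all entries
by `k`, adjoining a first column with entries `1,…,k` to component `m`, and adjoining
empty components `m+1,…,l`. -/
def addFirstCol (k m : ℕ) (t : Node → ℕ) : Node → ℕ := fun A =>
  if A.2.2 = m then (if A.2.1 = 1 then A.1 else k + t (A.1, A.2.1 - 1, m))
  else k + t A

/-- The tableau `t⁺` obtained from a tableau `t` of `μ_L(d-1,m)` by adjoining empty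
components `1,…,m-1` and adjoining a column `d` to component `m` with entries
`nk+1,…,nk+k` from top to bottom. -/
def addLastCol (nk m d : ℕ) (t : Node → ℕ) : Node → ℕ := fun A =>
  if A.2.2 = m then (if A.2.1 = d then nk + A.1 else t (A.1, A.2.1, 1))
  else t (A.1, A.2.1, A.2.2 - m + 1)

/-- The `i`-th smallest element of a finite set of naturals (1-based). -/
def nthElt (S : Finset ℕ) (i : ℕ) : ℕ := (S.sort (· ≤ ·)).getD (i - 1) 0

/-- The set `S_B` of entries of `t_λ` lying in the bottom region (component `> m`, or
component `m` in a row `> r₀`). -/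
noncomputable def SB (l n : ℕ) (lam : ℕ → ℕ → ℕ) (r₀ m : ℕ) : Finset ℕ :=
  (Finset.Icc 1 n).filter fun i =>
    ∃ A, InDiag lam A ∧ colTab l n lam A = i ∧ (m < A.2.2 ∨ (A.2.2 = m ∧ r₀ < A.1))

/-- The glued tableau `t #̄ s`: on the bottom region the entries are `lab_B ∘ t` and on
the top region they are `lab_T ∘ s`, where `lab_B`, `lab_T` are the order-preserving
bijections onto `S_B`, `S_T`. -/
def glueBT (S_B S_T : Finset ℕ) (r₀ m : ℕ) (tB tT : Node → ℕ) : Node → ℕ := fun A =>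
  if A.2.2 < m then nthElt S_T (tT A)
  else if A.2.2 = m then
    (if A.1 ≤ r₀ then nthElt S_T (tT A) else nthElt S_B (tB (A.1 - r₀, A.2.1, 1)))
  else nthElt S_B (tB (A.1, A.2.1, A.2.2 - m + 1))

/-- The residue of a node `(r, c, m)` with respect to the multicharge `κ`:
`κ_m + c - r` in `ℤ/eℤ` (with `ZMod 0 = ℤ` encoding `e = ∞`). -/
def resNode (e : ℕ) (κ : ℕ → ZMod e) (A : Node) : ZMod e :=
  κ A.2.2 + (A.2.1 : ZMod e) - (A.1 : ZMod e)

section NthElt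

theorem nthElt_eq_orderEmbOfFin (S : Finset ℕ) {i : ℕ} (hi : 1 ≤ i) (hi' : i ≤ S.card) :
    nthElt S i = S.orderEmbOfFin rfl ⟨i - 1, by omega⟩ := by
  rw [Finset.orderEmbOfFin_apply, nthElt, List.getD_eq_getElem]
  rfl

theorem nthElt_mem (S : Finset ℕ) {i : ℕ} (hi : 1 ≤ i) (hi' : i ≤ S.card) :
    nthElt S i ∈ S := by
  rw [nthElt_eq_orderEmbOfFin S hi hi']
  exact Finset.orderEmbOfFin_mem _ _ _

theorem nthElt_lt_nthElt (S : Finset ℕ) {i j : ℕ} (hi : 1 ≤ i) (hij : i < j)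
    (hj : j ≤ S.card) : nthElt S i < nthElt S j := by
  rw [nthElt_eq_orderEmbOfFin S hi (by omega), nthElt_eq_orderEmbOfFin S (by omega) hj]
  exact (S.orderEmbOfFin rfl).strictMono (Fin.mk_lt_mk.2 (by omega))

theorem nthElt_injOn (S : Finset ℕ) {i j : ℕ} (hi : 1 ≤ i) (hi' : i ≤ S.card)
    (hj : 1 ≤ j) (hj' : j ≤ S.card) (h : nthElt S i = nthElt S j) : i = j := by
  rcases lt_trichotomy i j with hlt | heq | hlt
  · exact absurd h (nthElt_lt_nthElt S hi hlt hj').ne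
  · exact heq
  · exact absurd h (nthElt_lt_nthElt S hj hlt hi').ne'

theorem exists_nthElt_eq (S : Finset ℕ) {y : ℕ} (hy : y ∈ S) :
    ∃ i, 1 ≤ i ∧ i ≤ S.card ∧ nthElt S i = y := by
  have hy' : y ∈ Set.range (S.orderEmbOfFin rfl) := by
    rw [Finset.range_orderEmbOfFin]; exact hy
  obtain ⟨⟨k, hk⟩, rfl⟩ := hy'
  exact ⟨k + 1, by omega, by omega, nthElt_eq_orderEmbOfFin S (by omega) (by omega)⟩

theorem card_filter_le_nthElt (S : Finset ℕ) {i : ℕ} (hi : 1 ≤ i) (hi' : i ≤ S.card) :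
    (S.filter (· ≤ nthElt S i)).card = i := by
  have h : S.filter (· ≤ nthElt S i) = (Finset.Icc 1 i).image (nthElt S) := by
    ext x
    simp only [Finset.mem_filter, Finset.mem_image, Finset.mem_Icc]
    constructor
    · rintro ⟨hx, hle⟩
      obtain ⟨j, hj, hj', rfl⟩ := exists_nthElt_eq S hx
      refine ⟨j, ⟨hj, ?_⟩, rfl⟩
      by_contra hlt
      exact absurd (nthElt_lt_nthElt S hi (not_le.1 hlt) hj') (not_lt.2 hle)
    · rintro ⟨j, ⟨hj, hji⟩, rfl⟩
      refine ⟨nthElt_mem S hj (hji.trans hi'), ?_⟩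
      rcases hji.eq_or_lt with rfl | hlt
      · exact le_rfl
      · exact (nthElt_lt_nthElt S hj hlt hi').le
  rw [h, Finset.card_image_of_injOn, Nat.card_Icc, Nat.add_sub_cancel]
  intro a ha b hb hab
  simp only [Finset.coe_Icc, Set.mem_Icc] at ha hb
  exact nthElt_injOn S ha.1 (ha.2.trans hi') hb.1 (hb.2.trans hi') hab

theorem nthElt_card_filter_le (S : Finset ℕ) {y : ℕ} (hy : y ∈ S) :
    nthElt S (S.filter (· ≤ y)).card = y := by
  obtain ⟨i, hi, hi', rfl⟩ := exists_nthElt_eq S hy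
  rw [card_filter_le_nthElt S hi hi']

end NthElt

section Shape

/-- `p` consists of `L` partitions, each with at most `N` nonzero rows. -/
def IsShape (L N : ℕ) (p : ℕ → ℕ → ℕ) : Prop :=
  (∀ k r, (k = 0 ∨ L < k ∨ r = 0 ∨ N < r) → p k r = 0) ∧
    ∀ k r, 1 ≤ r → p k (r + 1) ≤ p k r

/-- The Young diagram of `p` as a set. -/
def diag (p : ℕ → ℕ → ℕ) : Set Node := {A | InDiag p A}

/-- `B` weakly precedes `A` when reading down successive columns from left to right. -/
def ColLE (B A : Node) : Prop :=
  A.2.2 < B.2.2 ∨ (B.2.2 = A.2.2 ∧ (B.2.1 < A.2.1 ∨ (B.2.1 = A.2.1 ∧ B.1 ≤ A.1)))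

theorem ColLE.refl (A : Node) : ColLE A A := by simp [ColLE]

theorem ColLE.trans {A B C : Node} (h : ColLE A B) (h' : ColLE B C) : ColLE A C := by
  unfold ColLE at *; omega

theorem ColLE.total (A B : Node) : ColLE A B ∨ ColLE B A := by
  unfold ColLE; omega

theorem ColLE.antisymm {A B : Node} (h : ColLE A B) (h' : ColLE B A) : A = B := by
  obtain ⟨a, b, c⟩ := A
  obtain ⟨a', b', c'⟩ := B
  simp only [ColLE] at h h'
  simp only [Prod.mk.injEq]
  omega

variable {L N : ℕ} {p : ℕ → ℕ → ℕ}

theorem IsShape.le_of_inDiag (h : IsShape L N p) {A : Node} (hA : InDiag p A) :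
    1 ≤ A.2.2 ∧ A.2.2 ≤ L ∧ 1 ≤ A.1 ∧ A.1 ≤ N := by
  obtain ⟨h1, h2⟩ := hA
  by_contra hc
  have := h.1 A.2.2 A.1 (by omega)
  omega

theorem IsShape.antitone (h : IsShape L N p) (k : ℕ) {r r' : ℕ} (hr : 1 ≤ r) (hrr : r ≤ r') :
    p k r' ≤ p k r := by
  induction r', hrr using Nat.le_induction with
  | base => exact le_rfl
  | succ x hx ih => exact (h.2 k x (hr.trans hx)).trans ih

theorem IsShape.le_mpSize (h : IsShape L N p) (k r : ℕ) : p k r ≤ mpSize L N p := by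
  by_cases hk : k = 0 ∨ L < k ∨ r = 0 ∨ N < r
  · rw [h.1 k r hk]; exact Nat.zero_le _
  · have h1 : p k r ≤ ∑ r ∈ Finset.Icc 1 N, p k r :=
      Finset.single_le_sum (f := fun r => p k r) (fun _ _ => Nat.zero_le _)
        (Finset.mem_Icc.2 (by omega))
    exact h1.trans (Finset.single_le_sum (f := fun k => ∑ r ∈ Finset.Icc 1 N, p k r)
      (fun _ _ => Nat.zero_le _) (Finset.mem_Icc.2 (by omega)))

/-- The nodes of `p` with row in `1,…,N`, column in `C` and component in `K`. -/
noncomputable def box (N : ℕ) (p : ℕ → ℕ → ℕ) (C K : Finset ℕ) : Finset Node :=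
  (Finset.Icc 1 N ×ˢ C ×ˢ K).filter (InDiag p)

theorem mem_box {C K : Finset ℕ} {A : Node} :
    A ∈ box N p C K ↔ (1 ≤ A.1 ∧ A.1 ≤ N) ∧ A.2.1 ∈ C ∧ A.2.2 ∈ K ∧ InDiag p A := by
  simp [box, and_assoc]

theorem card_box_eq_sum_colLen {C K : Finset ℕ} (hC : ∀ c ∈ C, 1 ≤ c) :
    (box N p C K).card = ∑ k ∈ K, ∑ c ∈ C, colLen N p k c := by
  unfold box colLen
  simp_rw [Finset.card_filter]
  rw [Finset.sum_product, Finset.sum_comm, Finset.sum_product, Finset.sum_comm]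
  refine Finset.sum_congr rfl fun k _ => Finset.sum_congr rfl fun c hc =>
    Finset.sum_congr rfl fun r _ => ?_
  simp [InDiag, hC c hc]

theorem card_box_eq_sum_compSize {M : ℕ} {K : Finset ℕ} (hM : ∀ k r, p k r ≤ M) :
    (box N p (Finset.Icc 1 M) K).card = ∑ k ∈ K, compSize N p k := by
  rw [card_box_eq_sum_colLen fun c hc => (Finset.mem_Icc.1 hc).1]
  refine Finset.sum_congr rfl fun k _ => ?_
  unfold colLen compSize
  simp_rw [Finset.card_filter]
  rw [Finset.sum_comm]
  refine Finset.sum_congr rfl fun r _ => ?_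
  rw [← Finset.card_filter]
  have : (Finset.Icc 1 M).filter (· ≤ p k r) = Finset.Icc 1 (p k r) := by
    ext x
    have := hM k r
    simp only [Finset.mem_filter, Finset.mem_Icc]
    omega
  rw [this, Nat.card_Icc, Nat.add_sub_cancel]

theorem IsShape.diag_eq_box (h : IsShape L N p) :
    diag p = box N p (Finset.Icc 1 (mpSize L N p)) (Finset.Icc 1 L) := by
  ext A
  simp only [diag, Set.mem_ofPred_eq, Finset.mem_coe, mem_box, Finset.mem_Icc]
  refine ⟨fun hA => ?_, fun hA => hA.2.2.2⟩
  have h1 := h.le_of_inDiag hA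
  have h2 := h.le_mpSize A.2.2 A.1
  have h3 := hA.1
  have h4 := hA.2
  exact ⟨by omega, by omega, by omega, hA⟩

theorem IsShape.finite_diag (h : IsShape L N p) : (diag p).Finite := by
  rw [h.diag_eq_box]; exact Finset.finite_toSet _

theorem IsShape.ncard_diag (h : IsShape L N p) : (diag p).ncard = mpSize L N p := by
  rw [h.diag_eq_box, Set.ncard_coe_finset, card_box_eq_sum_compSize h.le_mpSize]
  rfl

theorem IsShape.inDiag_of_le (h : IsShape L N p) {A : Node} (hA : InDiag p A) {r c : ℕ}
    (hr : 1 ≤ r) (hrA : r ≤ A.1) (hc : 1 ≤ c) (hcA : c ≤ A.2.1) : InDiag p (r, c, A.2.2) :=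
  ⟨hc, hcA.trans (hA.2.trans (h.antitone A.2.2 hr hrA))⟩

theorem IsShape.row_le_ncard (h : IsShape L N p) {A : Node} (hA : InDiag p A) :
    A.1 ≤ (diag p).ncard := by
  have hsub : (↑((Finset.Icc 1 A.1).image fun r => ((r, 1, A.2.2) : Node)) : Set Node)
      ⊆ diag p := by
    intro B hB
    simp only [Finset.coe_image, Set.mem_image, Finset.mem_coe, Finset.mem_Icc] at hB
    obtain ⟨r, hr, rfl⟩ := hB
    exact h.inDiag_of_le hA hr.1 hr.2 le_rfl hA.1
  have := Set.ncard_le_ncard hsub h.finite_diag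
  rwa [Set.ncard_coe_finset, Finset.card_image_of_injective _ (fun a b hab => by simpa using hab),
    Nat.card_Icc, Nat.add_sub_cancel] at this

theorem IsShape.of_ncard_diag (h : IsShape L N p) {N' : ℕ} (hN' : (diag p).ncard = N') :
    IsShape L N' p := by
  refine ⟨fun k r hkr => ?_, h.2⟩
  by_contra hne
  have hA : InDiag p (r, 1, k) := ⟨le_rfl, Nat.one_le_iff_ne_zero.2 hne⟩
  have h1 := h.le_of_inDiag hA
  have h2 := h.row_le_ncard hA
  simp only at h1 h2
  omega

/-- The entry of `t_p` at `A` is the rank of `A` in the column reading order. -/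
theorem IsShape.colTab_eq_ncard (h : IsShape L N p) {A : Node} (hA : InDiag p A) :
    colTab L N p A = {B | InDiag p B ∧ ColLE B A}.ncard := by
  have hAb := h.le_of_inDiag hA
  set M := mpSize L N p with hM
  have key : {B | InDiag p B ∧ ColLE B A} =
      ↑(box N p (Finset.Icc 1 M) (Finset.Icc (A.2.2 + 1) L) ∪
        (box N p (Finset.Icc 1 (A.2.1 - 1)) {A.2.2} ∪
          (Finset.Icc 1 A.1).image fun r => ((r, A.2.1, A.2.2) : Node))) := by
    ext B
    simp only [Set.mem_ofPred_eq, Finset.coe_union, Set.mem_union, Finset.mem_coe, mem_box,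
      Finset.mem_image, Finset.mem_Icc, Finset.mem_singleton]
    constructor
    · rintro ⟨hB, hBA⟩
      have hBb := h.le_of_inDiag hB
      have hBM := hB.2.trans (h.le_mpSize B.2.2 B.1)
      have hB1 := hB.1
      rcases hBA with hlt | ⟨hk, hlt | ⟨hc, hr⟩⟩
      · exact Or.inl ⟨by omega, by omega, by omega, hB⟩
      · exact Or.inr (Or.inl ⟨by omega, by omega, hk, hB⟩)
      · exact Or.inr (Or.inr ⟨B.1, by omega, by rw [← hc, ← hk]⟩)
    · rintro (⟨-, -, hk, hB⟩ | ⟨-, hc, hk, hB⟩ | ⟨r, hr, rfl⟩)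
      · exact ⟨hB, Or.inl (by omega)⟩
      · exact ⟨hB, Or.inr ⟨hk, Or.inl (by omega)⟩⟩
      · exact ⟨h.inDiag_of_le hA hr.1 hr.2 hA.1 le_rfl, Or.inr ⟨rfl, Or.inr ⟨rfl, hr.2⟩⟩⟩
  rw [key, Set.ncard_coe_finset, Finset.card_union_of_disjoint, Finset.card_union_of_disjoint,
    card_box_eq_sum_compSize h.le_mpSize, card_box_eq_sum_colLen fun c hc => (Finset.mem_Icc.1 hc).1,
    Finset.card_image_of_injective _ (fun a b hab => by simpa using hab),
    Nat.card_Icc, Nat.add_sub_cancel, Finset.sum_singleton, colTab, add_assoc]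
  · rw [Finset.disjoint_left]
    intro B hB hB'
    simp only [mem_box, Finset.mem_image, Finset.mem_Icc, Finset.mem_singleton] at hB hB'
    obtain ⟨r, -, rfl⟩ := hB'
    have := hB.2.1
    simp only at this
    omega
  · rw [Finset.disjoint_left]
    intro B hB hB'
    simp only [Finset.mem_union, mem_box, Finset.mem_image, Finset.mem_Icc,
      Finset.mem_singleton] at hB hB'
    rcases hB' with hB' | ⟨r, -, rfl⟩
    · omega
    · have := hB.2.2.1
      simp only at this
      omega

theorem IsShape.colTab_le_iff (h : IsShape L N p) {A B : Node} (hA : InDiag p A)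
    (hB : InDiag p B) : colTab L N p B ≤ colTab L N p A ↔ ColLE B A := by
  have hfin : ∀ C, {B | InDiag p B ∧ ColLE B C}.Finite := fun C =>
    h.finite_diag.subset fun _ hx => hx.1
  rw [h.colTab_eq_ncard hA, h.colTab_eq_ncard hB]
  constructor
  · intro hle
    by_contra hBA
    have hAB := (ColLE.total A B).resolve_right hBA
    refine absurd (Set.ncard_lt_ncard (Set.ssubset_iff_of_subset ?_ |>.2 ?_) (hfin B))
      (not_lt.2 hle)
    · exact fun C hC => ⟨hC.1, hC.2.trans hAB⟩
    · exact ⟨B, ⟨hB, ColLE.refl B⟩, fun hB' => hBA hB'.2⟩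
  · intro hBA
    exact Set.ncard_le_ncard (fun C hC => ⟨hC.1, hC.2.trans hBA⟩) (hfin A)

theorem IsShape.colTab_injOn (h : IsShape L N p) : Set.InjOn (colTab L N p) (diag p) := by
  intro A hA B hB hAB
  exact ColLE.antisymm ((h.colTab_le_iff hB hA).1 hAB.le) ((h.colTab_le_iff hA hB).1 hAB.ge)

theorem IsShape.colTab_mem_Icc (h : IsShape L N p) {A : Node} (hA : InDiag p A) :
    1 ≤ colTab L N p A ∧ colTab L N p A ≤ (diag p).ncard := by
  constructor
  · have := h.le_of_inDiag hA
    unfold colTab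
    omega
  · rw [h.colTab_eq_ncard hA]
    exact Set.ncard_le_ncard (fun B hB => hB.1) h.finite_diag

theorem IsShape.image_colTab (h : IsShape L N p) :
    colTab L N p '' diag p = Set.Icc 1 (diag p).ncard := by
  refine Set.eq_of_subset_of_ncard_le ?_ ?_ (Set.finite_Icc _ _)
  · rintro _ ⟨A, hA, rfl⟩
    exact h.colTab_mem_Icc hA
  · rw [h.colTab_injOn.ncard_image, ← Finset.coe_Icc, Set.ncard_coe_finset,
      Nat.card_Icc, Nat.add_sub_cancel]

end Shape

section Region

variable {L N L' N' : ℕ} {p q : ℕ → ℕ → ℕ} {P : Node → Prop} {f : Node → Node}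
  {S : Finset ℕ}

theorem card_entries_eq_ncard_diag (hp : IsShape L N p)
    (hf : Set.BijOn f {A | InDiag p A ∧ P A} (diag q))
    (hS : ∀ x, x ∈ S ↔ ∃ A, (InDiag p A ∧ P A) ∧ colTab L N p A = x) :
    S.card = (diag q).ncard := by
  have h : (S : Set ℕ) = colTab L N p '' {A | InDiag p A ∧ P A} := by
    ext x; simp [hS]
  rw [← Set.ncard_coe_finset, h, (hp.colTab_injOn.mono fun A hA => hA.1).ncard_image,
    ← hf.image_eq, hf.injOn.ncard_image]

/-- If a region of the diagram of `p` is identified with the diagram of `q` compatibly with the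
column reading order, then `t_p` restricted to the region is the relabelling of `t_q`. -/
theorem nthElt_colTab (hp : IsShape L N p) (hq : IsShape L' N' q)
    (hf : Set.BijOn f {A | InDiag p A ∧ P A} (diag q))
    (hle : ∀ A B, P A → P B → (ColLE (f A) (f B) ↔ ColLE A B))
    (hS : ∀ x, x ∈ S ↔ ∃ A, (InDiag p A ∧ P A) ∧ colTab L N p A = x)
    {A : Node} (hA : InDiag p A) (hPA : P A) :
    nthElt S (colTab L' N' q (f A)) = colTab L N p A := by
  rw [← nthElt_card_filter_le S ((hS _).2 ⟨A, ⟨hA, hPA⟩, rfl⟩),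
    hq.colTab_eq_ncard (hf.mapsTo ⟨hA, hPA⟩)]
  congr 1
  have h1 : {B | InDiag q B ∧ ColLE B (f A)} = f '' {B | (InDiag p B ∧ P B) ∧ ColLE B A} := by
    ext B
    constructor
    · rintro ⟨hB, hBA⟩
      obtain ⟨C, hC, rfl⟩ := hf.surjOn hB
      exact ⟨C, ⟨hC, (hle C A hC.2 hPA).1 hBA⟩, rfl⟩
    · rintro ⟨C, ⟨hC, hCA⟩, rfl⟩
      exact ⟨hf.mapsTo hC, (hle C A hC.2 hPA).2 hCA⟩
  have h2 : (↑(S.filter (· ≤ colTab L N p A)) : Set ℕ) =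
      colTab L N p '' {B | (InDiag p B ∧ P B) ∧ ColLE B A} := by
    ext x
    simp only [Finset.coe_filter, Set.mem_ofPred_eq, hS, Set.mem_image]
    constructor
    · rintro ⟨⟨C, hC, rfl⟩, hCA⟩
      exact ⟨C, ⟨hC, (hp.colTab_le_iff hA hC.1).1 hCA⟩, rfl⟩
    · rintro ⟨C, ⟨hC, hCA⟩, rfl⟩
      exact ⟨⟨C, hC, rfl⟩, (hp.colTab_le_iff hA hC.1).2 hCA⟩
  rw [h1, (hf.injOn.mono fun B hB => hB.1).ncard_image, ← Set.ncard_coe_finset, h2,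
    (hp.colTab_injOn.mono fun B hB => hB.1.1).ncard_image]

end Region

section TopBottom

/-- `A` lies in the region of `λ_B(r₀, m)`. -/
def IsBottom (r₀ m : ℕ) (A : Node) : Prop := m < A.2.2 ∨ (A.2.2 = m ∧ r₀ < A.1)

/-- The identification of the bottom region with the diagram of `λ_B(r₀, m)`. -/
def botShift (r₀ m : ℕ) (A : Node) : Node :=
  if A.2.2 = m then (A.1 - r₀, A.2.1, 1) else (A.1, A.2.1, A.2.2 - m + 1)

variable {l n m r₀ : ℕ} {p : ℕ → ℕ → ℕ}

theorem inDiag_topPart {A : Node} :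
    InDiag (topPart p r₀ m) A ↔ InDiag p A ∧ ¬ IsBottom r₀ m A := by
  obtain ⟨r, c, k⟩ := A
  simp only [InDiag, topPart, IsBottom]
  split_ifs with h1 h2 h3
  · omega
  · subst h2; omega
  · omega
  · omega

theorem botShift_of_eq {A : Node} (h : A.2.2 = m) :
    botShift r₀ m A = (A.1 - r₀, A.2.1, 1) := if_pos h

theorem botShift_of_ne {A : Node} (h : A.2.2 ≠ m) :
    botShift r₀ m A = (A.1, A.2.1, A.2.2 - m + 1) := if_neg h

theorem inDiag_botPart_botShift (hp : ∀ k, p k 0 = 0) {A : Node} (hA : IsBottom r₀ m A) :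
    InDiag (botPart p r₀ m) (botShift r₀ m A) ↔ InDiag p A := by
  obtain ⟨r, c, k⟩ := A
  simp only [IsBottom] at hA
  by_cases hk : k = m
  · subst hk
    rw [botShift_of_eq (A := (r, c, k)) rfl]
    simp only [InDiag, botPart]
    rw [if_neg (by omega), if_pos trivial, Nat.add_sub_cancel' (by omega)]
  · rw [botShift_of_ne hk]
    simp only [InDiag, botPart]
    rcases Nat.eq_zero_or_pos r with rfl | hr
    · simp [hp]
    · rw [if_neg (by omega), if_neg (by omega), show m + (k - m + 1) - 1 = k by omega]

theorem exists_botShift_eq {B : Node} (hB : InDiag (botPart p r₀ m) B) :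
    ∃ A, IsBottom r₀ m A ∧ botShift r₀ m A = B := by
  obtain ⟨r, c, k⟩ := B
  simp only [InDiag, botPart] at hB
  split_ifs at hB with h1 h2
  · omega
  · subst h2
    refine ⟨(r₀ + r, c, m), Or.inr ⟨rfl, by simp only; omega⟩, ?_⟩
    rw [botShift_of_eq (A := (r₀ + r, c, m)) rfl, Nat.add_sub_cancel_left]
  · refine ⟨(r, c, m + k - 1), Or.inl (by simp only; omega), ?_⟩
    rw [botShift_of_ne (by simp only; omega)]
    simp only [Prod.mk.injEq, true_and]
    omega

theorem colLE_botShift_iff {A B : Node} (hA : IsBottom r₀ m A) (hB : IsBottom r₀ m B) :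
    ColLE (botShift r₀ m A) (botShift r₀ m B) ↔ ColLE A B := by
  unfold IsBottom at hA hB
  unfold botShift ColLE
  grind

theorem weaklyLeft_botShift_iff {A B : Node} (hA : IsBottom r₀ m A) (hB : IsBottom r₀ m B) :
    WeaklyLeft (botShift r₀ m A) (botShift r₀ m B) ↔ WeaklyLeft A B := by
  unfold IsBottom at hA hB
  unfold botShift WeaklyLeft
  grind

theorem bijOn_botShift (hp : ∀ k, p k 0 = 0) :
    Set.BijOn (botShift r₀ m) {A | InDiag p A ∧ IsBottom r₀ m A} (diag (botPart p r₀ m)) := by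
  refine ⟨fun A hA => (inDiag_botPart_botShift hp hA.2).2 hA.1, fun A hA B hB hAB => ?_,
    fun B hB => ?_⟩
  · refine ColLE.antisymm ?_ ?_
    · rw [← colLE_botShift_iff hA.2 hB.2, hAB]; exact ColLE.refl _
    · rw [← colLE_botShift_iff hB.2 hA.2, hAB]; exact ColLE.refl _
  · obtain ⟨A, hA, rfl⟩ := exists_botShift_eq hB
    exact ⟨A, ⟨(inDiag_botPart_botShift hp hA).1 hB, hA⟩, rfl⟩

theorem bijOn_id_topPart :
    Set.BijOn id {A | InDiag p A ∧ ¬ IsBottom r₀ m A} (diag (topPart p r₀ m)) := by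
  have : {A | InDiag p A ∧ ¬ IsBottom r₀ m A} = diag (topPart p r₀ m) := by
    ext A; exact inDiag_topPart.symm
  rw [this]
  exact Set.bijOn_id _

theorem IsShape.topPart {N : ℕ} (h : IsShape l N p) : IsShape m N (topPart p r₀ m) := by
  constructor
  · intro k r hk
    have := h.1 k r
    simp only [FS.topPart]
    split_ifs with h1 h2 h3
    · exact this (by omega)
    · subst h2; exact this (by omega)
    · rfl
    · rfl
  · intro k r hr
    simp only [FS.topPart]
    have := h.2 k r hr
    split_ifs with h1 h2 h3 h4 h5
    · exact this
    · subst h2; exact this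
    · omega
    · exact Nat.zero_le _
    · exact le_rfl
    · exact le_rfl

theorem IsShape.botPart {N : ℕ} (hm : m ≤ l) (h : IsShape l N p) :
    IsShape (l - m + 1) N (botPart p r₀ m) := by
  constructor
  · intro k r hk
    simp only [FS.botPart]
    split_ifs with h1 h2
    · rfl
    · exact h.1 _ _ (by omega)
    · exact h.1 _ _ (by omega)
  · intro k r hr
    simp only [FS.botPart]
    rcases Nat.eq_zero_or_pos k with rfl | hk
    · simp
    · have h1 : ¬ (k = 0 ∨ r = 0) := by omega
      have h2 : ¬ (k = 0 ∨ r + 1 = 0) := by omega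
      rw [if_neg h1, if_neg h2]
      split_ifs
      · exact h.2 m (r₀ + r) (by omega)
      · exact h.2 _ r hr

theorem mem_SB_iff (h : IsShape l n p) (hn : (diag p).ncard = n) (x : ℕ) :
    x ∈ SB l n p r₀ m ↔ ∃ A, (InDiag p A ∧ IsBottom r₀ m A) ∧ colTab l n p A = x := by
  simp only [SB, Finset.mem_filter, Finset.mem_Icc]
  constructor
  · rintro ⟨-, A, hA, hx, hb⟩
    exact ⟨A, ⟨hA, hb⟩, hx⟩
  · rintro ⟨A, ⟨hA, hb⟩, rfl⟩
    have := h.colTab_mem_Icc hA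
    exact ⟨by omega, A, hA, rfl, hb⟩

theorem mem_compl_SB_iff (h : IsShape l n p) (hn : (diag p).ncard = n) (x : ℕ) :
    x ∈ Finset.Icc 1 n \ SB l n p r₀ m ↔
      ∃ A, (InDiag p A ∧ ¬ IsBottom r₀ m A) ∧ colTab l n p A = x := by
  rw [Finset.mem_sdiff, mem_SB_iff h hn, Finset.mem_Icc]
  constructor
  · rintro ⟨hx, hnot⟩
    have hx' : x ∈ colTab l n p '' diag p := by
      rw [h.image_colTab, hn]; exact hx
    obtain ⟨A, hA, rfl⟩ := hx'
    exact ⟨A, ⟨hA, fun hb => hnot ⟨A, ⟨hA, hb⟩, rfl⟩⟩, rfl⟩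
  · rintro ⟨A, ⟨hA, hb⟩, rfl⟩
    have := h.colTab_mem_Icc hA
    refine ⟨by omega, ?_⟩
    rintro ⟨B, ⟨hB, hb'⟩, hAB⟩
    exact hb (h.colTab_injOn hB hA hAB ▸ hb')

theorem glueBT_of_isBottom {S_B S_T : Finset ℕ} {tB tT : Node → ℕ} {A : Node}
    (hA : IsBottom r₀ m A) :
    glueBT S_B S_T r₀ m tB tT A = nthElt S_B (tB (botShift r₀ m A)) := by
  unfold IsBottom at hA
  unfold glueBT botShift
  split_ifs <;> first | rfl | omega

theorem glueBT_of_not_isBottom {S_B S_T : Finset ℕ} {tB tT : Node → ℕ} {A : Node}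
    (hA : ¬ IsBottom r₀ m A) :
    glueBT S_B S_T r₀ m tB tT A = nthElt S_T (tT A) := by
  unfold IsBottom at hA
  unfold glueBT
  split_ifs <;> first | rfl | omega

/-- In a column-dominated tableau of shape `μ_T(r₀, m)`, the first `c` columns of component `m`
hold the same entries as in `t_λ` as soon as both `λ` and `μ` contain the node `(r₀, c, m)`. -/
theorem exists_colTab_topPart_eq {nT N N' c : ℕ} {lam mu : ℕ → ℕ → ℕ} {s : Node → ℕ}
    (hlam : IsShape l N lam) (hmu : IsShape l N' mu)
    (hlamT : IsShape m nT (topPart lam r₀ m)) (hcard : (diag (topPart lam r₀ m)).ncard = nT)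
    (hsTab : IsTab nT (topPart mu r₀ m) s)
    (hsDom : ColDomOn m nT (topPart lam r₀ m) (topPart mu r₀ m) s nT)
    (hlamc : InDiag lam (r₀, c, m)) (hmuc : InDiag mu (r₀, c, m)) :
    ∃ r' c', 1 ≤ r' ∧ r' ≤ r₀ ∧ 1 ≤ c' ∧ c' ≤ c ∧ InDiag lam (r', c', m) ∧
      colTab m nT (topPart lam r₀ m) (r', c', m) = s (r₀, c, m) := by
  set Z : Finset Node := Finset.Icc 1 r₀ ×ˢ Finset.Icc 1 c ×ˢ {m} with hZ
  have memZ : ∀ A : Node, A ∈ Z ↔ (1 ≤ A.1 ∧ A.1 ≤ r₀) ∧ (1 ≤ A.2.1 ∧ A.2.1 ≤ c) ∧ A.2.2 = m := by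
    intro A; simp only [hZ, Finset.mem_product, Finset.mem_Icc, Finset.mem_singleton]
  have hZlam : ∀ A ∈ Z, InDiag (topPart lam r₀ m) A := by
    rintro ⟨r, c', k⟩ hA
    obtain ⟨hr, hc, rfl⟩ := (memZ _).1 hA
    refine inDiag_topPart.2 ⟨hlam.inDiag_of_le hlamc hr.1 hr.2 hc.1 hc.2, ?_⟩
    simp only [IsBottom] at *
    omega
  have hex : ∀ A ∈ Z, ∃ B ∈ Z, s B = colTab m nT (topPart lam r₀ m) A := by
    intro A hA
    have hAl := hZlam A hA
    have hrange := hlamT.colTab_mem_Icc hAl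
    rw [hcard] at hrange
    obtain ⟨B, hB, hsB⟩ := hsTab.2.2 _ hrange.1 hrange.2
    refine ⟨B, ?_, hsB⟩
    have hleft := hsDom _ B A hrange.1 hrange.2 hB hsB hAl rfl
    obtain ⟨hBmu, hBtop⟩ := inDiag_topPart.1 hB
    have hBb := hmu.le_of_inDiag hBmu
    have hBc := hBmu.1
    rw [memZ] at hA ⊢
    unfold WeaklyLeft at hleft
    unfold IsBottom at hBtop
    omega
  choose! g hgZ hgs using hex
  have hginj : Set.InjOn g Z := by
    intro A hA B hB hAB
    refine hlamT.colTab_injOn (hZlam A hA) (hZlam B hB) ?_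
    rw [← hgs A hA, ← hgs B hB, hAB]
  have hmem : ((r₀, c, m) : Node) ∈ Z :=
    (memZ _).2 ⟨⟨(hmu.le_of_inDiag hmuc).2.2.1, le_rfl⟩, ⟨hmuc.1, le_rfl⟩, rfl⟩
  obtain ⟨⟨r', c', k⟩, hA, hgA⟩ := Finset.surjOn_of_injOn_of_card_le g hgZ hginj le_rfl hmem
  have hA' := hA
  rw [Finset.mem_coe, memZ] at hA'
  obtain ⟨hr, hc, rfl⟩ := hA'
  refine ⟨r', c', hr.1, hr.2, hc.1, hc.2, (inDiag_topPart.1 (hZlam _ hA)).1, ?_⟩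
  rw [← hgs _ hA, hgA]

end TopBottom

/-- If `t` is a `λ_B(r₀,m)`-column-dominated standard
`μ_B(r₀,m)`-tableau and `s` is a `λ_T(r₀,m)`-column-dominated standard
`μ_T(r₀,m)`-tableau, then the glued tableau `t #̄ s` is a `λ`-column-dominated standard
`μ`-tableau. -/
theorem glueBT_colDom_standard (l n : ℕ) (hl : 1 ≤ l) (hn : 1 ≤ n)
    (m r₀ : ℕ) (hm1 : 1 ≤ m) (hm2 : m ≤ l)
    (lam mu : ℕ → ℕ → ℕ) (hlam : IsMP l n lam) (hmu : IsMP l n mu)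
    (nT nB : ℕ)
    (hnT : nT = mpSize m n (topPart lam r₀ m))
    (heq : mpSize m n (topPart mu r₀ m) = nT)
    (hnB : nB = n - nT)
    (t : Node → ℕ)
    (htTab : IsTab nB (botPart mu r₀ m) t)
    (htStd : IsStd (botPart mu r₀ m) t)
    (htDom : ColDomOn (l - m + 1) nB (botPart lam r₀ m) (botPart mu r₀ m) t nB)
    (s : Node → ℕ)
    (hsTab : IsTab nT (topPart mu r₀ m) s)
    (hsStd : IsStd (topPart mu r₀ m) s)
    (hsDom : ColDomOn m nT (topPart lam r₀ m) (topPart mu r₀ m) s nT) :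
    IsTab n mu (glueBT (SB l n lam r₀ m) (Finset.Icc 1 n \ SB l n lam r₀ m) r₀ m t s) ∧
      IsStd mu (glueBT (SB l n lam r₀ m) (Finset.Icc 1 n \ SB l n lam r₀ m) r₀ m t s) ∧
      ColDomOn l n lam mu
        (glueBT (SB l n lam r₀ m) (Finset.Icc 1 n \ SB l n lam r₀ m) r₀ m t s) n := by
  have hl' : IsShape l n lam := ⟨hlam.1, hlam.2.1⟩
  have hm' : IsShape l n mu := ⟨hmu.1, hmu.2.1⟩
  have hcardl : (diag lam).ncard = n := hl'.ncard_diag.trans hlam.2.2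
  have hlam0 : ∀ k, lam k 0 = 0 := fun k => hlam.1 k 0 (by simp)
  have hmu0 : ∀ k, mu k 0 = 0 := fun k => hmu.1 k 0 (by simp)
  have hSB := mem_SB_iff (r₀ := r₀) (m := m) hl' hcardl
  have hST := mem_compl_SB_iff (r₀ := r₀) (m := m) hl' hcardl
  have hdisj : Disjoint (SB l n lam r₀ m) (Finset.Icc 1 n \ SB l n lam r₀ m) :=
    Finset.disjoint_sdiff
  have hsub : SB l n lam r₀ m ⊆ Finset.Icc 1 n := Finset.filter_subset _ _
  have hcardadd := Finset.card_sdiff_add_card_eq_card hsub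
  rw [Nat.card_Icc, Nat.add_sub_cancel] at hcardadd
  have hSBsub : ∀ x ∈ SB l n lam r₀ m, 1 ≤ x ∧ x ≤ n := fun x hx => Finset.mem_Icc.1 (hsub hx)
  have hSTsub : ∀ x ∈ Finset.Icc 1 n \ SB l n lam r₀ m, 1 ≤ x ∧ x ≤ n := fun x hx =>
    Finset.mem_Icc.1 (Finset.sdiff_subset hx)
  have hcover : ∀ x, 1 ≤ x → x ≤ n →
      x ∈ SB l n lam r₀ m ∨ x ∈ Finset.Icc 1 n \ SB l n lam r₀ m := by
    intro x h1 h2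
    by_cases hx : x ∈ SB l n lam r₀ m
    · exact Or.inl hx
    · exact Or.inr (Finset.mem_sdiff.2 ⟨Finset.mem_Icc.2 ⟨h1, h2⟩, hx⟩)
  have hcT : (diag (topPart lam r₀ m)).ncard = nT := hl'.topPart.ncard_diag.trans hnT.symm
  have hcardT := (card_entries_eq_ncard_diag hl' bijOn_id_topPart hST).trans hcT
  have hcB := card_entries_eq_ncard_diag hl' (bijOn_botShift hlam0) hSB
  have hcardB : (SB l n lam r₀ m).card = nB := by omega
  have hshT : IsShape m nT (topPart lam r₀ m) := hl'.topPart.of_ncard_diag hcT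
  have hshB : IsShape (l - m + 1) nB (botPart lam r₀ m) :=
    (hl'.botPart hm2).of_ncard_diag (hcB.symm.trans hcardB)
  have htop : ∀ A, InDiag lam A → ¬ IsBottom r₀ m A →
      nthElt (Finset.Icc 1 n \ SB l n lam r₀ m) (colTab m nT (topPart lam r₀ m) A) =
        colTab l n lam A := fun A hA hAt =>
    nthElt_colTab hl' hshT bijOn_id_topPart (fun _ _ _ _ => Iff.rfl) hST hA hAt
  have hbot : ∀ A, InDiag lam A → IsBottom r₀ m A →
      nthElt (SB l n lam r₀ m)
        (colTab (l - m + 1) nB (botPart lam r₀ m) (botShift r₀ m A)) = colTab l n lam A :=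
    fun A hA hAb => nthElt_colTab hl' hshB (bijOn_botShift hlam0)
      (fun _ _ => colLE_botShift_iff) hSB hA hAb
  have htoprange : ∀ A, InDiag lam A → ¬ IsBottom r₀ m A →
      1 ≤ colTab m nT (topPart lam r₀ m) A ∧
        colTab m nT (topPart lam r₀ m) A ≤ (Finset.Icc 1 n \ SB l n lam r₀ m).card := by
    intro A hA hAt
    have := hshT.colTab_mem_Icc (inDiag_topPart.2 ⟨hA, hAt⟩)
    omega
  have hbotrange : ∀ A, InDiag lam A → IsBottom r₀ m A →
      1 ≤ colTab (l - m + 1) nB (botPart lam r₀ m) (botShift r₀ m A) ∧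
        colTab (l - m + 1) nB (botPart lam r₀ m) (botShift r₀ m A) ≤
          (SB l n lam r₀ m).card := by
    intro A hA hAb
    have := hshB.colTab_mem_Icc ((inDiag_botPart_botShift hlam0 hAb).2 hA)
    omega
  have hsr : ∀ A, InDiag mu A → ¬ IsBottom r₀ m A → 1 ≤ s A ∧ s A ≤ nT :=
    fun A hA hAt => hsTab.1 A (inDiag_topPart.2 ⟨hA, hAt⟩)
  have htr : ∀ A, InDiag mu A → IsBottom r₀ m A →
      1 ≤ t (botShift r₀ m A) ∧ t (botShift r₀ m A) ≤ nB :=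
    fun A hA hAb => htTab.1 _ ((inDiag_botPart_botShift hmu0 hAb).2 hA)
  rw [← hcardT] at hsr
  rw [← hcardB] at htr
  set ST := Finset.Icc 1 n \ SB l n lam r₀ m with hSTdef
  set S := SB l n lam r₀ m with hSdef
  have hdomB : ∀ A B, InDiag mu A → IsBottom r₀ m A → InDiag lam B → IsBottom r₀ m B →
      colTab l n lam B = nthElt S (t (botShift r₀ m A)) → WeaklyLeft A B := by
    intro A B hA hAb hB hBb hAB
    rw [← hbot B hB hBb] at hAB
    have hrB := hbotrange B hB hBb
    have hrA := htr A hA hAb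
    have heq' := nthElt_injOn S hrB.1 hrB.2 hrA.1 hrA.2 hAB
    rw [← weaklyLeft_botShift_iff hAb hBb]
    exact htDom _ _ _ hrA.1 (by omega) ((inDiag_botPart_botShift hmu0 hAb).2 hA) rfl
      ((inDiag_botPart_botShift hlam0 hBb).2 hB) heq'
  have hdomT : ∀ A B, InDiag mu A → ¬ IsBottom r₀ m A → InDiag lam B → ¬ IsBottom r₀ m B →
      colTab l n lam B = nthElt ST (s A) → WeaklyLeft A B := by
    intro A B hA hAt hB hBt hAB
    rw [← htop B hB hBt] at hAB
    have hrB := htoprange B hB hBt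
    have hrA := hsr A hA hAt
    have heq' := nthElt_injOn ST hrB.1 hrB.2 hrA.1 hrA.2 hAB
    exact hsDom _ _ _ hrA.1 (by omega) (inDiag_topPart.2 ⟨hA, hAt⟩) rfl
      (inDiag_topPart.2 ⟨hB, hBt⟩) heq'
  have hmemB : ∀ A, InDiag mu A → IsBottom r₀ m A → nthElt S (t (botShift r₀ m A)) ∈ S :=
    fun A hA hAb => nthElt_mem S (htr A hA hAb).1 (htr A hA hAb).2
  have hmemT : ∀ A, InDiag mu A → ¬ IsBottom r₀ m A → nthElt ST (s A) ∈ ST :=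
    fun A hA hAt => nthElt_mem ST (hsr A hA hAt).1 (hsr A hA hAt).2
  refine ⟨⟨?_, ?_, ?_⟩, ⟨?_, ?_⟩, ?_⟩
  · intro A hA
    by_cases hAb : IsBottom r₀ m A
    · rw [glueBT_of_isBottom hAb]
      exact hSBsub _ (hmemB A hA hAb)
    · rw [glueBT_of_not_isBottom hAb]
      exact hSTsub _ (hmemT A hA hAb)
  · intro A B hA hB hAB
    by_cases hAb : IsBottom r₀ m A <;> by_cases hBb : IsBottom r₀ m B
    · rw [glueBT_of_isBottom hAb, glueBT_of_isBottom hBb] at hAB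
      have hrA := htr A hA hAb
      have hrB := htr B hB hBb
      exact (bijOn_botShift hmu0).injOn ⟨hA, hAb⟩ ⟨hB, hBb⟩
        (htTab.2.1 _ _ ((inDiag_botPart_botShift hmu0 hAb).2 hA)
          ((inDiag_botPart_botShift hmu0 hBb).2 hB)
          (nthElt_injOn S hrA.1 hrA.2 hrB.1 hrB.2 hAB))
    · rw [glueBT_of_isBottom hAb, glueBT_of_not_isBottom hBb] at hAB
      exact absurd (hAB ▸ hmemT B hB hBb) (Finset.disjoint_left.1 hdisj (hmemB A hA hAb))
    · rw [glueBT_of_not_isBottom hAb, glueBT_of_isBottom hBb] at hAB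
      exact absurd (hAB ▸ hmemT A hA hAb) (Finset.disjoint_left.1 hdisj (hmemB B hB hBb))
    · rw [glueBT_of_not_isBottom hAb, glueBT_of_not_isBottom hBb] at hAB
      have hrA := hsr A hA hAb
      have hrB := hsr B hB hBb
      exact hsTab.2.1 _ _ (inDiag_topPart.2 ⟨hA, hAb⟩) (inDiag_topPart.2 ⟨hB, hBb⟩)
        (nthElt_injOn ST hrA.1 hrA.2 hrB.1 hrB.2 hAB)
  · intro i hi hi'
    rcases hcover i hi hi' with hx | hx
    · obtain ⟨j, hj, hj', rfl⟩ := exists_nthElt_eq _ hx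
      obtain ⟨B, hB, rfl⟩ := htTab.2.2 j hj (by omega)
      obtain ⟨A, hAb, rfl⟩ := exists_botShift_eq hB
      exact ⟨A, (inDiag_botPart_botShift hmu0 hAb).1 hB, glueBT_of_isBottom hAb⟩
    · obtain ⟨j, hj, hj', rfl⟩ := exists_nthElt_eq _ hx
      obtain ⟨A, hA, rfl⟩ := hsTab.2.2 j hj (by omega)
      obtain ⟨hAmu, hAt⟩ := inDiag_topPart.1 hA
      exact ⟨A, hAmu, glueBT_of_not_isBottom hAt⟩
  · intro r c k hA hB
    by_cases hAb : IsBottom r₀ m (r, c, k)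
    · have hBb : IsBottom r₀ m (r, c + 1, k) := hAb
      rw [glueBT_of_isBottom hAb, glueBT_of_isBottom hBb]
      refine nthElt_lt_nthElt S (htr _ hA hAb).1 ?_ (htr _ hB hBb).2
      have hA' := (inDiag_botPart_botShift hmu0 hAb).2 hA
      have hB' := (inDiag_botPart_botShift hmu0 hBb).2 hB
      by_cases hk : k = m
      · rw [botShift_of_eq hk] at hA' hB' ⊢
        rw [botShift_of_eq hk]
        exact htStd.1 _ _ _ hA' hB'
      · rw [botShift_of_ne hk] at hA' hB' ⊢
        rw [botShift_of_ne hk]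
        exact htStd.1 _ _ _ hA' hB'
    · have hBb : ¬ IsBottom r₀ m (r, c + 1, k) := hAb
      rw [glueBT_of_not_isBottom hAb, glueBT_of_not_isBottom hBb]
      exact nthElt_lt_nthElt ST (hsr _ hA hAb).1
        (hsStd.1 _ _ _ (inDiag_topPart.2 ⟨hA, hAb⟩) (inDiag_topPart.2 ⟨hB, hBb⟩))
        (hsr _ hB hBb).2
  · intro r c k hA hB
    by_cases hAb : IsBottom r₀ m (r, c, k)
    · have hBb : IsBottom r₀ m (r + 1, c, k) := by
        simp only [IsBottom] at hAb ⊢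
        omega
      rw [glueBT_of_isBottom hAb, glueBT_of_isBottom hBb]
      refine nthElt_lt_nthElt S (htr _ hA hAb).1 ?_ (htr _ hB hBb).2
      have hA' := (inDiag_botPart_botShift hmu0 hAb).2 hA
      have hB' := (inDiag_botPart_botShift hmu0 hBb).2 hB
      by_cases hk : k = m
      · have hr : r + 1 - r₀ = r - r₀ + 1 := by
          simp only [IsBottom] at hAb
          omega
        rw [botShift_of_eq hk] at hA' hB' ⊢
        rw [botShift_of_eq hk]
        simp only [hr] at hB' ⊢
        exact htStd.2 _ _ _ hA' hB'
      · rw [botShift_of_ne hk] at hA' hB' ⊢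
        rw [botShift_of_ne hk]
        exact htStd.2 _ _ _ hA' hB'
    · by_cases hBb : IsBottom r₀ m (r + 1, c, k)
      · obtain ⟨rfl, rfl⟩ : k = m ∧ r = r₀ := by
          simp only [IsBottom] at hAb hBb
          omega
        rw [glueBT_of_not_isBottom hAb, glueBT_of_isBottom hBb]
        obtain ⟨B, ⟨hBl, hBbot⟩, hBeq⟩ := (hSB _).1 (hmemB _ hB hBb)
        have hleft := hdomB _ B hB hBb hBl hBbot hBeq
        have hr1 := (hm'.le_of_inDiag hA).2.2.1
        have hc1 := hA.1
        obtain ⟨rB, cB, kB⟩ := B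
        simp only [WeaklyLeft, IsBottom] at hleft hBbot hr1 hc1
        obtain ⟨rfl, hrB, hcB'⟩ : kB = k ∧ r < rB ∧ c ≤ cB := by omega
        obtain ⟨r', c', h1, h2, h3, h4, hC, hCeq⟩ :=
          exists_colTab_topPart_eq hl' hm' hshT hcT hsTab hsDom
            (hl'.inDiag_of_le hBl hr1 hrB.le hc1 hcB') hA
        have hCt : ¬ IsBottom r kB (r', c', kB) := by
          simp only [IsBottom]
          omega
        rw [← hBeq, ← hCeq, htop _ hC hCt, ← not_le, hl'.colTab_le_iff hC hBl]
        simp only [ColLE]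
        omega
      · rw [glueBT_of_not_isBottom hAb, glueBT_of_not_isBottom hBb]
        exact nthElt_lt_nthElt ST (hsr _ hA hAb).1
          (hsStd.2 _ _ _ (inDiag_topPart.2 ⟨hA, hAb⟩) (inDiag_topPart.2 ⟨hB, hBb⟩))
          (hsr _ hB hBb).2
  · intro i A B _ _ hA hAi hB hBi
    by_cases hAb : IsBottom r₀ m A
    · rw [glueBT_of_isBottom hAb] at hAi
      have hiS : i ∈ S := hAi ▸ hmemB A hA hAb
      have hBb : IsBottom r₀ m B := by
        by_contra hBt
        exact Finset.disjoint_left.1 hdisj hiS ((hST i).2 ⟨B, ⟨hB, hBt⟩, hBi⟩)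
      exact hdomB A B hA hAb hB hBb (hBi.trans hAi.symm)
    · rw [glueBT_of_not_isBottom hAb] at hAi
      have hiS : i ∈ ST := hAi ▸ hmemT A hA hAb
      have hBb : ¬ IsBottom r₀ m B := fun hBb =>
        Finset.disjoint_left.1 hdisj ((hSB i).2 ⟨B, ⟨hB, hBb⟩, hBi⟩) hiS
      exact hdomT A B hA hAb hB hBb (hBi.trans hAi.symm)

end FS
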